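/- Let m > 0, E_l = sqrt(|l|²+m²), and let f, g, h, i : R^3 → C be smooth compactly supported functions such that for all p in supp(f) and q in supp(g), p/E_p ≠ q/E_q (equivalently p ≠ q). Then the oscillatory integral I(t) = ∫∫∫ d³p d³q d³k h(k) i(p+q−k) f(p) g(q) e^{−it(E_p+E_q−E_k−E_{p+q−k})} tends to 0 as |t| → ∞. -/

import Mathlib

open MeasureTheory Filter

noncomputable def E (m : ℝ) (l : EuclideanSpace ℝ (Fin 3)) : ℝ :=
  Real.sqrt (‖l‖ ^ 2 + m ^ 2)

lemma osc_half (a : ℝ → ℂ) (φ φ' : ℝ → ℝ) (s : Set ℝ) (hs : MeasurableSet s)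
    (hφ : ∀ x, HasDerivAt φ (φ' x) x) (hne : ∀ x ∈ s, φ' x ≠ 0) (hinj : Set.InjOn φ s) :
    Tendsto (fun t : ℝ => ∫ x in s, a x * Complex.exp (Complex.I * t * (φ x : ℝ)))
      (cocompact ℝ) (nhds 0) := by
  set G : ℝ → ℂ := Set.indicator (φ '' s)
    (fun u => |φ' (Function.invFunOn φ s u)|⁻¹ • a (Function.invFunOn φ s u)) with hG
  have himg : MeasurableSet (φ '' s) :=
    hs.image_of_continuousOn_injOn
      (fun x _ => (hφ x).continuousAt.continuousWithinAt) hinj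
  have h1 := Real.tendsto_integral_exp_smul_cocompact G
  have hc : (-(1 / (2 * Real.pi)) : ℝ) ≠ 0 := by
    have := Real.pi_pos
    simp [this.ne']
  have h2 := h1.comp (Homeomorph.mulRight₀ _ hc).isClosedEmbedding.tendsto_cocompact
  refine h2.congr fun t => ?_
  simp only [Function.comp_apply, Homeomorph.coe_mulRight₀]
  have e1 : ∀ v : ℝ, Real.fourierChar (-(v * (t * -(1 / (2 * Real.pi))))) • G v
      = Set.indicator (φ '' s) (fun v => Complex.exp (Complex.I * t * v) *
        (|φ' (Function.invFunOn φ s v)|⁻¹ • a (Function.invFunOn φ s v))) v := by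
    intro v
    by_cases hv : v ∈ φ '' s
    · rw [Set.indicator_of_mem hv, hG, Set.indicator_of_mem hv, Circle.smul_def,
        Real.fourierChar_apply, smul_eq_mul]
      congr 2
      have := Real.pi_pos.ne'
      push_cast
      have h3 : (Real.pi : ℂ) ≠ 0 := by exact_mod_cast this
      field_simp
    · rw [Set.indicator_of_notMem hv, hG, Set.indicator_of_notMem hv, smul_zero]
  simp_rw [e1]
  rw [integral_indicator himg, integral_image_eq_integral_abs_deriv_smul hs
    (fun x _ => (hφ x).hasDerivWithinAt) hinj]
  refine setIntegral_congr_fun hs fun x hx => ?_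
  have hx' : Function.invFunOn φ s (φ x) = x := hinj.leftInvOn_invFunOn hx
  have h4 : (|φ' x| : ℝ) ≠ 0 := abs_ne_zero.mpr (hne x hx)
  simp only [hx', Complex.real_smul]
  have h5 : ((|φ' x| : ℝ) : ℂ) ≠ 0 := by exact_mod_cast h4
  push_cast
  field_simp

lemma norm_osc (t y : ℝ) : ‖Complex.exp (Complex.I * t * (y : ℝ))‖ = 1 := by
  have : Complex.I * t * (y : ℝ) = ((t * y : ℝ) : ℂ) * Complex.I := by push_cast; ring
  rw [this, Complex.norm_exp_ofReal_mul_I]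

lemma osc1 (a : ℝ → ℂ) (φ φ' : ℝ → ℝ) (ha : Integrable a)
    (hφ : ∀ x, HasDerivAt φ (φ' x) x) (hm : StrictMono φ') :
    Tendsto (fun t : ℝ => ∫ x, a x * Complex.exp (Complex.I * t * (φ x : ℝ)))
      (cocompact ℝ) (nhds 0) := by
  have hcφ : Continuous φ := continuous_iff_continuousAt.2 fun x => (hφ x).continuousAt
  have hd : deriv φ = φ' := funext fun x => (hφ x).deriv
  have hmeas : Measurable φ' := hm.monotone.measurable
  have hp : MeasurableSet {x | 0 < φ' x} := measurableSet_lt measurable_const hmeas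
  have hn : MeasurableSet {x | φ' x < 0} := measurableSet_lt hmeas measurable_const
  have hcp : Convex ℝ {x | 0 < φ' x} := by
    apply Set.OrdConnected.convex
    exact ⟨fun x hx y _ z hz => lt_of_lt_of_le hx (hm.monotone hz.1)⟩
  have hcn : Convex ℝ {x | φ' x < 0} := by
    apply Set.OrdConnected.convex
    exact ⟨fun x _ y hy z hz => lt_of_le_of_lt (hm.monotone hz.2) hy⟩
  have t1 := osc_half a φ φ' _ hp hφ (fun x hx => ne_of_gt hx)
    (strictMonoOn_of_deriv_pos hcp hcφ.continuousOn
      (fun x hx => by rw [hd]; exact (interior_subset hx : x ∈ {x | 0 < φ' x}))).injOn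
  have t2 := osc_half a φ φ' _ hn hφ (fun x hx => ne_of_lt hx)
    (strictAntiOn_of_deriv_neg hcn hcφ.continuousOn
      (fun x hx => by rw [hd]; exact (interior_subset hx : x ∈ {x | φ' x < 0}))).injOn
  have t3 := t1.add t2
  rw [add_zero] at t3
  refine t3.congr fun t => ?_
  have hint : Integrable (fun x => a x * Complex.exp (Complex.I * t * (φ x : ℝ))) := by
    refine ha.mul_bdd (c := 1) ?_ (Eventually.of_forall fun x => (norm_osc t _).le)
    exact (by fun_prop : Continuous fun x => Complex.exp (Complex.I * t * (φ x : ℝ))).aestronglyMeasurable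
  rw [← setIntegral_union _ hn hint.integrableOn hint.integrableOn]
  · conv_rhs => rw [← setIntegral_univ]
    refine setIntegral_congr_set ?_
    have hsub : {x | φ' x = 0}.Subsingleton := fun x hx y hy => hm.injective (hx.trans hy.symm)
    rw [eventuallyEq_univ, mem_ae_iff]
    refine measure_mono_null ?_ (hsub.measure_zero volume)
    intro x hx
    simp only [Set.mem_compl_iff, Set.mem_union, Set.mem_ofPred_eq, not_or, not_lt] at hx ⊢
    exact le_antisymm hx.1 hx.2
  · rw [Set.disjoint_left]
    intro x hx hy
    have h1 : 0 < φ' x := hx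
    have h2 : φ' x < 0 := hy
    exact lt_asymm h1 h2

lemma sm_aux (A : ℝ) (hA : 0 < A) : StrictMono fun u : ℝ => u / Real.sqrt (u ^ 2 + A) := by
  intro u v huv
  have hu : 0 < u ^ 2 + A := by positivity
  have hv : 0 < v ^ 2 + A := by positivity
  show u / _ < v / _
  rw [div_lt_div_iff₀ (Real.sqrt_pos.2 hu) (Real.sqrt_pos.2 hv)]
  have su := Real.sqrt_pos.2 hu
  have sv := Real.sqrt_pos.2 hv
  have qu := Real.sq_sqrt hu.le
  have qv := Real.sq_sqrt hv.le
  set x := Real.sqrt (u ^ 2 + A)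
  set y := Real.sqrt (v ^ 2 + A)
  rcases le_or_gt 0 u with h | h
  · refine lt_of_pow_lt_pow_left₀ 2 (by nlinarith) ?_
    rw [mul_pow, mul_pow, qu, qv]
    nlinarith [mul_pos hA (by nlinarith : 0 < v ^ 2 - u ^ 2)]
  · rcases le_or_gt 0 v with h' | h'
    · nlinarith [mul_pos (neg_pos.2 h) sv, mul_nonneg h' su.le]
    · have : (-v) * x < (-u) * y := by
        refine lt_of_pow_lt_pow_left₀ 2 (by nlinarith) ?_
        rw [mul_pow, mul_pow, qu, qv]
        nlinarith [mul_pos hA (by nlinarith : 0 < u ^ 2 - v ^ 2)]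
      linarith

lemma deriv_aux (A b : ℝ) (hA : 0 < A) (s : ℝ) :
    HasDerivAt (fun s : ℝ => Real.sqrt ((s - b) ^ 2 + A))
      ((s - b) / Real.sqrt ((s - b) ^ 2 + A)) s := by
  have h : HasDerivAt (fun s : ℝ => (s - b) ^ 2 + A) (2 * (s - b)) s := by
    have := (((hasDerivAt_id s).sub_const b).pow 2).add_const A
    simpa using this
  have := h.sqrt (by positivity)
  convert this using 1
  field_simp

instance : (cocompact ℝ).IsCountablyGenerated := by
  rw [cocompact_eq_atBot_atTop]; infer_instance

lemma E_cont (m : ℝ) : Continuous (E m) := by unfold E; fun_prop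

noncomputable def ins (z : ℝ × (Fin 2 → ℝ)) : EuclideanSpace ℝ (Fin 3) :=
  WithLp.toLp 2 (Fin.cons z.1 z.2)

lemma ins_mp : ∃ e : (ℝ × (Fin 2 → ℝ)) ≃ᵐ EuclideanSpace ℝ (Fin 3),
    (⇑e = ins) ∧ MeasurePreserving e := by
  refine ⟨(MeasurableEquiv.piFinSuccAbove (fun _ : Fin 3 => ℝ) 0).symm.trans
    (MeasurableEquiv.toLp 2 (Fin 3 → ℝ)), ?_, ?_⟩
  · ext z j
    simp [ins, MeasurableEquiv.piFinSuccAbove]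
  · exact (PiLp.volume_preserving_toLp (Fin 3)).comp
      (volume_preserving_piFinSuccAbove (fun _ : Fin 3 => ℝ) 0).symm

lemma E_ins (m : ℝ) (s : ℝ) (y : Fin 2 → ℝ) :
    E m (ins (s, y)) = Real.sqrt ((s - 0) ^ 2 + ((y 0) ^ 2 + (y 1) ^ 2 + m ^ 2)) := by
  unfold E
  congr 1
  rw [EuclideanSpace.norm_sq_eq]
  simp [ins, Fin.sum_univ_succ]
  ring

lemma E_sub_ins (m : ℝ) (P : EuclideanSpace ℝ (Fin 3)) (s : ℝ) (y : Fin 2 → ℝ) :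
    E m (P - ins (s, y)) = Real.sqrt ((s - P 0) ^ 2 +
      ((P 1 - y 0) ^ 2 + (P 2 - y 1) ^ 2 + m ^ 2)) := by
  unfold E
  congr 1
  rw [EuclideanSpace.norm_sq_eq]
  simp [ins, Fin.sum_univ_succ]
  ring

lemma osc3 (m : ℝ) (hm : 0 < m) (P : EuclideanSpace ℝ (Fin 3))
    (a : EuclideanSpace ℝ (Fin 3) → ℂ) (ha : Integrable a) :
    Tendsto (fun t : ℝ => ∫ k, a k * Complex.exp (Complex.I * t * (E m k + E m (P - k) : ℝ)))
      (cocompact ℝ) (nhds 0) := by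
  obtain ⟨e, he, hmp⟩ := ins_mp
  have hE := E_cont m
  have hint : ∀ t : ℝ, Integrable
      (fun k => a k * Complex.exp (Complex.I * t * (E m k + E m (P - k) : ℝ))) := by
    intro t
    refine ha.mul_bdd (c := 1) ?_ (Eventually.of_forall fun x => (norm_osc t _).le)
    exact (by fun_prop : Continuous fun k : EuclideanSpace ℝ (Fin 3) =>
      Complex.exp (Complex.I * t * (E m k + E m (P - k) : ℝ))).aestronglyMeasurable
  have hint' : ∀ t : ℝ, Integrable (fun z : ℝ × (Fin 2 → ℝ) => a (ins z) *
      Complex.exp (Complex.I * t * (E m (ins z) + E m (P - ins z) : ℝ)))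
      ((volume : Measure ℝ).prod volume) := by
    intro t
    have := (hmp.integrable_comp_emb e.measurableEmbedding).2 (hint t)
    rw [he] at this
    exact this
  have ha' : Integrable (fun z : ℝ × (Fin 2 → ℝ) => a (ins z))
      ((volume : Measure ℝ).prod volume) := by
    have := (hmp.integrable_comp_emb e.measurableEmbedding).2 ha
    rw [he] at this
    exact this
  have key : ∀ t : ℝ, ∫ k, a k * Complex.exp (Complex.I * t * (E m k + E m (P - k) : ℝ))
      = ∫ y : Fin 2 → ℝ, ∫ s : ℝ, a (ins (s, y)) *
      Complex.exp (Complex.I * t * (E m (ins (s, y)) + E m (P - ins (s, y)) : ℝ)) := by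
    intro t
    rw [← hmp.integral_comp e.measurableEmbedding, he]
    exact integral_prod_symm _ (hint' t)
  simp_rw [key]
  rw [← integral_zero (Fin 2 → ℝ) ℂ]
  refine tendsto_integral_filter_of_dominated_convergence
    (fun y => ∫ s : ℝ, ‖a (ins (s, y))‖) ?_ ?_ ?_ ?_
  · exact Eventually.of_forall fun t => (hint' t).integral_prod_right.aestronglyMeasurable
  · refine Eventually.of_forall fun t => Eventually.of_forall fun y => ?_
    refine (norm_integral_le_integral_norm _).trans (le_of_eq ?_)
    simp only [norm_mul, norm_osc, mul_one]
  · exact ha'.norm.integral_prod_right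
  · filter_upwards [ha'.prod_left_ae] with y hy
    have hA : 0 < (y 0) ^ 2 + (y 1) ^ 2 + m ^ 2 := by positivity
    have hB : 0 < (P 1 - y 0) ^ 2 + (P 2 - y 1) ^ 2 + m ^ 2 := by positivity
    refine osc1 (fun s => a (ins (s, y))) (fun s => E m (ins (s, y)) + E m (P - ins (s, y)))
      (fun s => (s - 0) / Real.sqrt ((s - 0) ^ 2 + ((y 0) ^ 2 + (y 1) ^ 2 + m ^ 2)) +
        (s - P 0) / Real.sqrt ((s - P 0) ^ 2 + ((P 1 - y 0) ^ 2 + (P 2 - y 1) ^ 2 + m ^ 2)))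
      hy (fun s => ?_) ?_
    · simp_rw [E_ins, E_sub_ins]
      exact (deriv_aux _ 0 hA s).add (deriv_aux _ (P 0) hB s)
    · refine StrictMono.add ?_ ?_
      · exact (sm_aux _ hA).comp (fun u v h => sub_lt_sub_right h _)
      · exact (sm_aux _ hB).comp (fun u v h => sub_lt_sub_right h _)

theorem stmt_6 (m : ℝ) (hm : 0 < m)
    (f g h i : EuclideanSpace ℝ (Fin 3) → ℂ)
    (hf : ContDiff ℝ (⊤ : ℕ∞) f) (hg : ContDiff ℝ (⊤ : ℕ∞) g) (hh : ContDiff ℝ (⊤ : ℕ∞) h)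
    (hi : ContDiff ℝ (⊤ : ℕ∞) i)
    (hfc : HasCompactSupport f) (hgc : HasCompactSupport g)
    (hhc : HasCompactSupport h) (hic : HasCompactSupport i)
    (hsep : ∀ p ∈ tsupport f, ∀ q ∈ tsupport g,
      (E m p)⁻¹ • p ≠ (E m q)⁻¹ • q) :
    Tendsto (fun t : ℝ =>
        ∫ p : EuclideanSpace ℝ (Fin 3), ∫ q : EuclideanSpace ℝ (Fin 3),
          ∫ k : EuclideanSpace ℝ (Fin 3),
            h k * i (p + q - k) * f p * g q *
              Complex.exp (-Complex.I * t *
                (E m p + E m q - E m k - E m (p + q - k) : ℝ)))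
      (cocompact ℝ) (nhds 0) := by
  have cf := hf.continuous
  have cg := hg.continuous
  have ch := hh.continuous
  have ci := hi.continuous
  have hE := E_cont m
  have If := cf.integrable_of_hasCompactSupport hfc (μ := volume)
  have Ig := cg.integrable_of_hasCompactSupport hgc (μ := volume)
  have Ih := ch.integrable_of_hasCompactSupport hhc (μ := volume)
  obtain ⟨C, hC⟩ := hic.exists_bound_of_continuous ci
  have hnexp : ∀ t y : ℝ, ‖Complex.exp (-Complex.I * t * (y : ℝ))‖ = 1 := by
    intro t y
    have := norm_osc (-t) y
    rw [← this]; congr 2; push_cast; ring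
  -- joint measurability
  have M2 : ∀ t : ℝ, StronglyMeasurable (fun z : EuclideanSpace ℝ (Fin 3) × EuclideanSpace ℝ (Fin 3) =>
      ∫ k : EuclideanSpace ℝ (Fin 3),
            h k * i (z.1 + z.2 - k) * f z.1 * g z.2 *
              Complex.exp (-Complex.I * t *
                (E m z.1 + E m z.2 - E m k - E m (z.1 + z.2 - k) : ℝ))) := by
    intro t
    have : Continuous (fun w : (EuclideanSpace ℝ (Fin 3) × EuclideanSpace ℝ (Fin 3)) ×
        EuclideanSpace ℝ (Fin 3) =>
        h w.2 * i (w.1.1 + w.1.2 - w.2) * f w.1.1 * g w.1.2 *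
              Complex.exp (-Complex.I * t *
                (E m w.1.1 + E m w.1.2 - E m w.2 - E m (w.1.1 + w.1.2 - w.2) : ℝ))) := by
      fun_prop
    exact this.stronglyMeasurable.integral_prod_right
  have B2 : ∀ (t : ℝ) (p q : EuclideanSpace ℝ (Fin 3)), ‖∫ k : EuclideanSpace ℝ (Fin 3),
            h k * i (p + q - k) * f p * g q *
              Complex.exp (-Complex.I * t *
                (E m p + E m q - E m k - E m (p + q - k) : ℝ))‖
      ≤ ‖f p‖ * ((C * ∫ k, ‖h k‖) * ‖g q‖) := by
    intro t p q
    refine (norm_integral_le_of_norm_le (g := fun k => ‖h k‖ * (C * ‖f p‖ * ‖g q‖))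
      (Ih.norm.mul_const _) (Eventually.of_forall fun k => ?_)).trans (le_of_eq ?_)
    · rw [norm_mul, hnexp, mul_one, norm_mul, norm_mul, norm_mul]
      have := hC (p + q - k)
      calc _ ≤ ‖h k‖ * C * ‖f p‖ * ‖g q‖ := by gcongr
        _ = _ := by ring
    · rw [integral_mul_const]; ring
  rw [← integral_zero (EuclideanSpace ℝ (Fin 3)) ℂ]
  refine tendsto_integral_filter_of_dominated_convergence
    (fun p => ‖f p‖ * ∫ q, ((C * ∫ k, ‖h k‖) * ‖g q‖)) ?_ ?_ (If.norm.mul_const _) ?_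
  · exact Eventually.of_forall fun t => (M2 t).integral_prod_right.aestronglyMeasurable
  · refine Eventually.of_forall fun t => Eventually.of_forall fun p => ?_
    rw [← integral_const_mul]
    exact norm_integral_le_of_norm_le ((Ig.norm.const_mul _).const_mul _)
      (Eventually.of_forall fun q => B2 t p q)
  refine Eventually.of_forall fun p => ?_
  rw [← integral_zero (EuclideanSpace ℝ (Fin 3)) ℂ]
  refine tendsto_integral_filter_of_dominated_convergence
    (fun q => ‖f p‖ * ((C * ∫ k, ‖h k‖) * ‖g q‖)) ?_ ?_
    ((Ig.norm.const_mul _).const_mul _) ?_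
  · exact Eventually.of_forall fun t =>
      ((M2 t).comp_measurable (measurable_prodMk_left (x := p))).aestronglyMeasurable
  · exact Eventually.of_forall fun t => Eventually.of_forall fun q => B2 t p q
  refine Eventually.of_forall fun q => ?_
  have Ia : Integrable (fun k => h k * i (p + q - k)) :=
    Ih.mul_bdd (c := C) (by fun_prop : Continuous fun k => i (p + q - k)).aestronglyMeasurable
      (Eventually.of_forall fun k => hC _)
  have T := osc3 m hm (p + q) _ Ia
  rw [tendsto_zero_iff_norm_tendsto_zero] at T ⊢
  have T' := T.const_mul (‖f p‖ * ‖g q‖)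
  rw [mul_zero] at T'
  refine T'.congr fun t => ?_
  have : ∀ k, h k * i (p + q - k) * f p * g q *
              Complex.exp (-Complex.I * t *
                (E m p + E m q - E m k - E m (p + q - k) : ℝ))
      = (f p * g q * Complex.exp (-Complex.I * t * (E m p + E m q : ℝ))) *
        (h k * i (p + q - k) * Complex.exp (Complex.I * t * (E m k + E m (p + q - k) : ℝ))) := by
    intro k
    have e : Complex.exp (-Complex.I * t *
                (E m p + E m q - E m k - E m (p + q - k) : ℝ))
        = Complex.exp (-Complex.I * t * (E m p + E m q : ℝ)) *
          Complex.exp (Complex.I * t * (E m k + E m (p + q - k) : ℝ)) := by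
      rw [← Complex.exp_add]; congr 1; push_cast; ring
    rw [e]; ring
  simp_rw [this]
  rw [integral_const_mul, norm_mul, norm_mul, norm_mul, hnexp, mul_one]
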